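/- (Combinatorial reciprocity between Dyck paths and Schröder paths.) For all integers m, n ≥ 1 and all integers a, b with 0 ≤ b ≤ a ≤ n−1, the following identity holds in ℚ: C(n−b−2, a−b)·C(−mn, n−1−a) + m·C(n−b−1, a−b)·C(−mn−1, n−a−2) = (−1)^{n−1−a} · #{S : S is an m-divisible positive (m,1)-Schröder path of height n with dg(S) = a and cd(S) = b}. (The left-hand side is the count of (m,1)-Dyck paths of height n with a m-valleys and b returns, viewed as a polynomial in m and evaluated at −m.) -/

import Mathlib

/-- A step of a lattice path: north `(0,1)`, east `(1,0)` or diagonal `(1,1)`. -/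
inductive Step : Type
  | N : Step
  | E : Step
  | D : Step
  deriving DecidableEq

/-- The displacement vector of a step. -/
def stepVec : Step → ℤ × ℤ
  | .N => (0, 1)
  | .E => (1, 0)
  | .D => (1, 1)

/-- The lattice point reached after the first `k` steps of the path `P` (starting at the
origin). -/
def pt (P : List Step) (k : ℕ) : ℤ × ℤ := ((P.take k).map stepVec).sum

/-- The path `P` starts with at least `t` north steps. -/
def StartsNorth (t : ℤ) (P : List Step) : Prop := List.replicate t.toNat Step.N <+: P

/-- The path `P` stays weakly above the line `x = m·y`. -/
def AboveLine (m : ℤ) (P : List Step) : Prop := ∀ k : ℕ, (pt P k).1 ≤ m * (pt P k).2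

/-- An `(m,t)`-Schröder path of height `n`: a lattice path from `(0,0)` to `(mn,n)` using
north, east and diagonal steps, starting with at least `t` north steps and never going
below the line `x = m·y`. -/
def IsSchroeder (m n t : ℤ) (P : List Step) : Prop :=
  StartsNorth t P ∧ pt P P.length = (m * n, n) ∧ AboveLine m P

/-- An `(m,t)`-Dyck path of height `n`: an `(m,t)`-Schröder path of height `n` with no
diagonal steps. -/
def IsDyck (m n t : ℤ) (P : List Step) : Prop :=
  IsSchroeder m n t P ∧ ∀ s ∈ P, s ≠ Step.D

/-- A Schröder path is small if none of its diagonal steps starts on the line `x = m·y`. -/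
def IsSmall (m : ℤ) (P : List Step) : Prop :=
  ∀ j : ℕ, P[j]? = some Step.D → (pt P j).1 ≠ m * (pt P j).2

/-- A Schröder path is positive if it touches the line `x = m·y` only at its two
endpoints. -/
def IsPositive (m : ℤ) (P : List Step) : Prop :=
  ∀ k : ℕ, 0 < k → k < P.length → (pt P k).1 ≠ m * (pt P k).2

/-- The set of indices `j` such that the `j`-th step of `P` is east and the `(j+1)`-st is
north; the corresponding valley point is `pt P (j+1)`. -/
def valleys (P : List Step) : Finset ℕ :=
  (Finset.range P.length).filter fun j => P[j]? = some Step.E ∧ P[j + 1]? = some Step.N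

/-- The number of valleys of `P`. -/
def val (P : List Step) : ℕ := (valleys P).card

/-- The number of valleys of `P` whose `x`-coordinate is congruent to `i` modulo `m`. -/
def ival (m i : ℤ) (P : List Step) : ℕ :=
  ((valleys P).filter fun j => (pt P (j + 1)).1 % m = i % m).card

/-- The set of returns of `P`: valleys of the form `(m·i, i)`. -/
def returns (m : ℤ) (P : List Step) : Finset ℕ :=
  (valleys P).filter fun j => (pt P (j + 1)).1 = m * (pt P (j + 1)).2

/-- The number of returns of `P`. -/
def ret (m : ℤ) (P : List Step) : ℕ := (returns m P).card

/-- The set of indices of diagonal steps of `P`. -/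
def diags (P : List Step) : Finset ℕ :=
  (Finset.range P.length).filter fun j => P[j]? = some Step.D

/-- The number of diagonal steps of `P`. -/
def dg (P : List Step) : ℕ := (diags P).card

/-- A Schröder path is `m`-divisible if every diagonal step ends at an `x`-coordinate
divisible by `m`. -/
def MDivisible (m : ℤ) (P : List Step) : Prop :=
  ∀ j ∈ diags P, m ∣ (pt P (j + 1)).1

/-- The number of cornered diagonal steps of `P`: diagonal steps connecting `(i·m − 1, i)`
to `(i·m, i + 1)` for some `i`. -/
def cd (m : ℤ) (P : List Step) : ℕ :=
  ((diags P).filter fun j => (pt P (j + 1)).1 = m * ((pt P (j + 1)).2 - 1)).card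

/-- The generalized binomial coefficient `C(p,q) = p(p−1)⋯(p−q+1)/q!` for integers `p` and
`q ≥ 0`, and `C(p,q) = 0` for `q < 0`. -/
def C (p q : ℤ) : ℤ :=
  if q < 0 then 0
  else if 0 ≤ p then (p.toNat.choose q.toNat : ℤ)
  else (-1) ^ q.toNat * ((q - p - 1).toNat.choose q.toNat : ℤ)

/-! ### Binomial identities -/

theorem C_of_neg {p q : ℤ} (hq : q < 0) : C p q = 0 := by
  simp [C, hq]

theorem C_zero_right (p : ℤ) : C p 0 = 1 := by
  simp [C]

theorem C_natCast (p q : ℕ) : C p q = (p.choose q : ℤ) := by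
  simp [C]

theorem C_neg_natCast (X k : ℕ) :
    C (-(X : ℤ)) k = (-1) ^ k * (X.multichoose k : ℤ) := by
  rcases Nat.eq_zero_or_pos X with rfl | hX
  · cases k <;> simp [C]
  · have h1 : ¬ (k : ℤ) < 0 := by omega
    have h2 : ¬ (0 : ℤ) ≤ -(X : ℤ) := by omega
    have h3 : ((k : ℤ) - -(X : ℤ) - 1).toNat = X + k - 1 := by omega
    rw [C, if_neg h1, if_neg h2, h3, Int.toNat_natCast, Nat.multichoose_eq]

theorem C_pascal (p q : ℤ) : C (p + 1) q = C p q + C p (q - 1) := by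
  rcases lt_trichotomy q 0 with hq | rfl | hq
  · rw [C_of_neg hq, C_of_neg hq, C_of_neg (by omega), add_zero]
  · rw [C_zero_right, C_zero_right, C_of_neg (by omega), add_zero]
  · obtain ⟨k, rfl⟩ : ∃ k : ℕ, q = ((k + 1 : ℕ) : ℤ) := ⟨(q - 1).toNat, by omega⟩
    have hk : ((k + 1 : ℕ) : ℤ) - 1 = (k : ℤ) := by omega
    rw [hk]
    rcases le_or_gt 0 p with hp | hp
    · lift p to ℕ using hp
      rw [show (p : ℤ) + 1 = ((p + 1 : ℕ) : ℤ) by omega, C_natCast, C_natCast, C_natCast,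
        Nat.choose_succ_succ]
      push_cast
      ring
    · obtain ⟨X, rfl⟩ : ∃ X : ℕ, p = -((X + 1 : ℕ) : ℤ) := ⟨(-p - 1).toNat, by omega⟩
      rw [show -((X + 1 : ℕ) : ℤ) + 1 = -(X : ℤ) by omega, C_neg_natCast, C_neg_natCast,
        C_neg_natCast, Nat.multichoose_succ_succ]
      push_cast
      ring

/-- The coefficient of `z ^ k` in `(1 - z) ^ (-X)`. -/
def multi (X k : ℤ) : ℤ := if k < 0 then 0 else (X.toNat.multichoose k.toNat : ℤ)

theorem multi_of_neg {X k : ℤ} (hk : k < 0) : multi X k = 0 := by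
  simp [multi, hk]

theorem multi_natCast (X k : ℕ) : multi X k = (X.multichoose k : ℤ) := by
  simp [multi]

theorem multi_zero_right (X : ℤ) : multi X 0 = 1 := by
  simp [multi]

theorem multi_rec {X : ℤ} (hX : 1 ≤ X) (k : ℤ) :
    multi X k = multi X (k - 1) + multi (X - 1) k := by
  rcases lt_trichotomy k 0 with hk | rfl | hk
  · rw [multi_of_neg hk, multi_of_neg hk, multi_of_neg (by omega), add_zero]
  · rw [multi_zero_right, multi_zero_right, multi_of_neg (by omega), zero_add]
  · obtain ⟨k, rfl⟩ : ∃ j : ℕ, k = ((j + 1 : ℕ) : ℤ) := ⟨(k - 1).toNat, by omega⟩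
    obtain ⟨X, rfl⟩ : ∃ j : ℕ, X = ((j + 1 : ℕ) : ℤ) := ⟨(X - 1).toNat, by omega⟩
    rw [show ((k + 1 : ℕ) : ℤ) - 1 = (k : ℤ) by omega,
      show ((X + 1 : ℕ) : ℤ) - 1 = (X : ℤ) by omega, multi_natCast, multi_natCast,
      multi_natCast, Nat.multichoose_succ_succ]
    push_cast
    ring

theorem C_neg_eq_multi {X : ℤ} (hX : 0 ≤ X) (k : ℤ) :
    C (-X) k = (-1) ^ k.toNat * multi X k := by
  rcases lt_or_ge k 0 with hk | hk
  · rw [C_of_neg hk, multi_of_neg hk, mul_zero]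
  · lift X to ℕ using hX
    lift k to ℕ using hk
    rw [C_neg_natCast, multi_natCast, Int.toNat_natCast]

theorem succ_mul_multichoose_succ (X k : ℕ) :
    (k + 1) * X.multichoose (k + 1) = X * (X + 1).multichoose k := by
  rcases X with _ | X
  · simp
  · have h := Nat.add_one_mul_choose_eq (X + k + 1) k
    have h2 := Nat.choose_succ_right_eq (X + k + 1) k
    rw [Nat.multichoose_eq, Nat.multichoose_eq]
    rw [show X + 1 + (k + 1) - 1 = X + k + 1 by omega,
      show X + 1 + 1 + k - 1 = X + k + 1 by omega]
    rw [show X + k + 1 - k = X + 1 by omega] at h2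
    linarith

theorem C_mul_multi_eq {m r : ℤ} (hm : 1 ≤ m) (hr : 1 ≤ r) (d : ℤ) :
    C (r - 1) d * multi (m * r) (r - d) = m * C r d * multi (m * r + 1) (r - d - 1) := by
  rcases lt_or_ge d 0 with hd | hd
  · simp [C_of_neg hd]
  rcases lt_trichotomy r d with h | rfl | h
  · rw [multi_of_neg (by omega), multi_of_neg (by omega), mul_zero, mul_zero]
  · rw [multi_of_neg (k := r - r - 1) (by omega)]
    lift r to ℕ using hd
    rw [show (r : ℤ) - 1 = ((r - 1 : ℕ) : ℤ) by omega, C_natCast,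
      Nat.choose_eq_zero_of_lt (by omega)]
    simp
  · lift d to ℕ using hd
    lift m to ℕ using by omega
    obtain ⟨k, rfl⟩ : ∃ k : ℕ, r = ((d + k + 1 : ℕ) : ℤ) := ⟨(r - d - 1).toNat, by omega⟩
    rw [show ((d + k + 1 : ℕ) : ℤ) - 1 = ((d + k : ℕ) : ℤ) by omega,
      show ((d + k + 1 : ℕ) : ℤ) - d = ((k + 1 : ℕ) : ℤ) by omega,
      show ((k + 1 : ℕ) : ℤ) - 1 = (k : ℤ) by omega,
      show (m : ℤ) * ((d + k + 1 : ℕ) : ℤ) + 1 = ((m * (d + k + 1) + 1 : ℕ) : ℤ) by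
        push_cast; ring,
      show (m : ℤ) * ((d + k + 1 : ℕ) : ℤ) = ((m * (d + k + 1) : ℕ) : ℤ) by push_cast; ring,
      C_natCast, C_natCast, multi_natCast, multi_natCast]
    have h1 := succ_mul_multichoose_succ (m * (d + k + 1)) k
    have h2 := Nat.choose_mul_succ_eq (d + k) d
    rw [show d + k + 1 - d = k + 1 by omega] at h2
    norm_cast
    apply Nat.eq_of_mul_eq_mul_left (Nat.succ_pos k)
    calc (k + 1) * ((d + k).choose d * (m * (d + k + 1)).multichoose (k + 1))
        = (d + k).choose d * ((k + 1) * (m * (d + k + 1)).multichoose (k + 1)) := by ring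
      _ = m * ((d + k).choose d * (d + k + 1)) * (m * (d + k + 1) + 1).multichoose k := by
          rw [h1]; ring
      _ = _ := by rw [h2]; simp only [Nat.succ_eq_add_one]; ring

/-! ### The closed formula for the number of path completions -/

/-- The number of completions of a path with `X` columns and height `Y` left, `r` undecided
multiples of `m` left, `d` diagonal steps left and `c` cornered diagonal steps left. -/
def completions (m r X Y d c : ℤ) : ℤ :=
  C (r - 1 - c) (d - c) * multi X (Y - d) - m * C (r - c) (d - c) * multi (X + 1) (Y - d - 1)

theorem completions_of_neg (m r X : ℤ) {Y d c : ℤ} (hY : Y < 0) (hc : 0 ≤ c) :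
    completions m r X Y d c = 0 := by
  unfold completions
  rcases lt_or_ge d 0 with hd | hd
  · rw [C_of_neg (by omega), C_of_neg (by omega)]; ring
  · rw [multi_of_neg (by omega), multi_of_neg (by omega)]; ring

theorem completions_rec (m r : ℤ) {X : ℤ} (hX : 1 ≤ X) (Y d c : ℤ) :
    completions m r X Y d c =
      completions m r X (Y - 1) d c + completions m r (X - 1) Y d c := by
  unfold completions
  rw [multi_rec hX (Y - d), multi_rec (X := X + 1) (by omega) (Y - d - 1),
    show Y - 1 - d = Y - d - 1 by ring, show X + 1 - 1 = X by ring,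
    show X - 1 + 1 = X by ring]
  ring

theorem completions_decide (m r X Y d c : ℤ) :
    completions m r X Y d c =
      completions m (r - 1) X Y d c + completions m (r - 1) X (Y - 1) (d - 1) c := by
  unfold completions
  have h1 := C_pascal (r - 1 - 1 - c) (d - c)
  have h2 := C_pascal (r - 1 - c) (d - c)
  rw [show r - 1 - 1 - c + 1 = r - 1 - c by ring] at h1
  rw [show r - 1 - c + 1 = r - c by ring] at h2
  rw [show Y - 1 - (d - 1) = Y - d by ring, show d - 1 - c = d - c - 1 by ring]
  linear_combination multi X (Y - d) * h1 - m * multi (X + 1) (Y - d - 1) * h2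

theorem completions_corner (m r X Y d c : ℤ) :
    completions m r X Y d c = completions m (r - 1) X (Y - 1) (d - 1) (c - 1) := by
  unfold completions
  ring_nf

/-- On the lower boundary only a cornered diagonal step can follow, so there are no completions
without one. -/
theorem completions_boundary {m r : ℤ} (hm : 1 ≤ m) (hr : 1 ≤ r) (d : ℤ) :
    completions m r (m * r) r d 0 = 0 := by
  unfold completions
  have := C_mul_multi_eq hm hr d
  simp only [sub_zero]
  linarith

theorem completions_zero (m d : ℤ) {c : ℤ} (hc : 0 ≤ c) :
    completions m 0 0 0 d c = if d = 0 ∧ c = 0 then 1 else 0 := by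
  unfold completions
  split_ifs with h
  · obtain ⟨rfl, rfl⟩ := h
    simp [C, multi]
  · rcases lt_trichotomy d 0 with hd | rfl | hd
    · rw [C_of_neg (by omega), C_of_neg (by omega)]; ring
    · rw [C_of_neg (by omega), C_of_neg (by omega)]; ring
    · rw [multi_of_neg (by omega), multi_of_neg (by omega)]; ring

/-! ### Path completions -/

theorem pt_zero (P : List Step) : pt P 0 = 0 := by
  simp [pt]

theorem pt_nil (k : ℕ) : pt [] k = 0 := by
  simp [pt]

theorem pt_cons_succ (s : Step) (l : List Step) (k : ℕ) :
    pt (s :: l) (k + 1) = stepVec s + pt l k := by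
  simp [pt]

theorem pt_of_length_le (P : List Step) {k : ℕ} (hk : P.length ≤ k) :
    pt P k = pt P P.length := by
  simp [pt, List.take_of_length_le hk]

theorem mem_diags (P : List Step) (j : ℕ) : j ∈ diags P ↔ P[j]? = some Step.D := by
  simp only [diags, Finset.mem_filter, Finset.mem_range, and_iff_right_iff_imp]
  intro h
  exact (List.getElem?_eq_some_iff.mp h).1

/-- The number of diagonal steps of `P` whose endpoint satisfies `Q`. -/
def diagCount (Q : ℤ × ℤ → Prop) [DecidablePred Q] (P : List Step) : ℕ :=
  ((diags P).filter fun j => Q (pt P (j + 1))).card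

theorem diagCount_nil (Q : ℤ × ℤ → Prop) [DecidablePred Q] : diagCount Q [] = 0 := by
  simp [diagCount, diags]

theorem diagCount_cons (Q : ℤ × ℤ → Prop) [DecidablePred Q] (s : Step) (l : List Step) :
    diagCount Q (s :: l) =
      diagCount (fun v => Q (stepVec s + v)) l + if s = Step.D ∧ Q (stepVec s) then 1 else 0 := by
  simp only [diagCount, diags, Finset.filter_filter, Finset.card_filter, List.length_cons]
  rw [Finset.sum_range_succ']
  simp [pt_cons_succ, pt_zero]

/-- `P` is a path with displacement `(X, Y)`, whose interior points stay strictly above the line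
of slope `1 / m` through its endpoint, with `d` diagonal steps, each of which ends at a multiple
of `m` columns before the end, and with `c` cornered diagonal steps. -/
def IsCompletion (m X Y d c : ℤ) (P : List Step) : Prop :=
  pt P P.length = (X, Y) ∧
  (∀ k : ℕ, 0 < k → k < P.length → m * (Y - (pt P k).2) < X - (pt P k).1) ∧
  (∀ j : ℕ, P[j]? = some Step.D → m ∣ X - (pt P (j + 1)).1) ∧
  (diagCount (fun _ => True) P : ℤ) = d ∧
  (diagCount (fun v => X - v.1 = m * (Y - v.2 + 1)) P : ℤ) = c

theorem isCompletion_nil (m X Y d c : ℤ) :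
    IsCompletion m X Y d c [] ↔ X = 0 ∧ Y = 0 ∧ d = 0 ∧ c = 0 := by
  simp only [IsCompletion, diagCount_nil, pt_nil, Prod.ext_iff]
  simp
  grind

theorem isCompletion_cons (m X Y d c : ℤ) (s : Step) (l : List Step) :
    IsCompletion m X Y d c (s :: l) ↔
      (l = [] ∨ m * (Y - (stepVec s).2) < X - (stepVec s).1) ∧
      (s = Step.D → m ∣ X - (stepVec s).1) ∧
      IsCompletion m (X - (stepVec s).1) (Y - (stepVec s).2)
        (d - if s = Step.D then 1 else 0)
        (c - if s = Step.D ∧ X - (stepVec s).1 = m * (Y - (stepVec s).2 + 1) then 1 else 0) l := by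
  have e1 : pt (s :: l) (s :: l).length = (X, Y) ↔
      pt l l.length = (X - (stepVec s).1, Y - (stepVec s).2) := by
    simp only [List.length_cons, pt_cons_succ, Prod.ext_iff, Prod.fst_add, Prod.snd_add]
    constructor <;> rintro ⟨h, h'⟩ <;> constructor <;> linarith
  have e2 : (∀ k : ℕ, 0 < k → k < (s :: l).length →
        m * (Y - (pt (s :: l) k).2) < X - (pt (s :: l) k).1) ↔
      (l = [] ∨ m * (Y - (stepVec s).2) < X - (stepVec s).1) ∧
      ∀ k : ℕ, 0 < k → k < l.length →
        m * (Y - (stepVec s).2 - (pt l k).2) < X - (stepVec s).1 - (pt l k).1 := by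
    constructor
    · intro h
      refine ⟨?_, fun k _ hk => ?_⟩
      · rcases l with _ | ⟨t, l⟩
        · simp
        · right
          simpa [pt_cons_succ, pt_zero] using h 1 (by simp) (by simp)
      · simpa [pt_cons_succ, sub_sub] using h (k + 1) (by simp) (by simpa using hk)
    · rintro ⟨h0, h⟩ k hk hkl
      obtain ⟨k, rfl⟩ : ∃ j, k = j + 1 := ⟨k - 1, by omega⟩
      rcases Nat.eq_zero_or_pos k with rfl | hk'
      · rcases h0 with rfl | h0
        · simp at hkl
        · simpa [pt_cons_succ, pt_zero] using h0
      · simpa [pt_cons_succ, sub_sub] using h k hk' (by simpa using hkl)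
  have e3 : (∀ j : ℕ, (s :: l)[j]? = some Step.D → m ∣ X - (pt (s :: l) (j + 1)).1) ↔
      (s = Step.D → m ∣ X - (stepVec s).1) ∧
      ∀ j : ℕ, l[j]? = some Step.D → m ∣ X - (stepVec s).1 - (pt l (j + 1)).1 := by
    constructor
    · intro h
      refine ⟨fun hs => ?_, fun j hj => ?_⟩
      · simpa [pt_cons_succ, pt_zero] using h 0 (by simpa using hs)
      · simpa [pt_cons_succ, sub_sub] using h (j + 1) (by simpa using hj)
    · rintro ⟨h0, h⟩ j hj
      rcases j with _ | j
      · simpa [pt_cons_succ, pt_zero] using h0 (by simpa using hj)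
      · simpa [pt_cons_succ, sub_sub] using h j (by simpa using hj)
  unfold IsCompletion
  rw [e1, e2, e3, diagCount_cons, diagCount_cons]
  simp only [Prod.fst_add, Prod.snd_add, and_true, ← sub_sub, Nat.cast_add, Nat.cast_ite,
    Nat.cast_one, Nat.cast_zero, eq_sub_iff_add_eq]
  tauto

theorem IsCompletion.nonneg {m X Y d c : ℤ} {P : List Step} (h : IsCompletion m X Y d c P) :
    0 ≤ X ∧ 0 ≤ Y := by
  induction P generalizing X Y d c with
  | nil => rw [isCompletion_nil] at h; omega
  | cons s l ih =>
    have := ih ((isCompletion_cons ..).mp h).2.2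
    cases s <;> simp [stepVec] at this <;> omega

theorem IsCompletion.cornered_nonneg {m X Y d c : ℤ} {P : List Step}
    (h : IsCompletion m X Y d c P) : 0 ≤ c := by
  rw [← h.2.2.2.2]
  positivity

theorem isCompletion_zero_zero (m d c : ℤ) (P : List Step) :
    IsCompletion m 0 0 d c P ↔ P = [] ∧ d = 0 ∧ c = 0 := by
  rcases P with _ | ⟨s, l⟩
  · simp [isCompletion_nil]
  · simp only [reduceCtorEq, false_and, iff_false]
    intro h
    have := ((isCompletion_cons ..).mp h).2.2.nonneg
    cases s <;> simp [stepVec] at this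

/-- The set `A` is finite with `z` elements. -/
def HasCard {α : Type*} (A : Set α) (z : ℤ) : Prop := A.Finite ∧ (A.ncard : ℤ) = z

theorem HasCard.empty {α : Type*} : HasCard (∅ : Set α) 0 := by
  simp [HasCard]

theorem HasCard.image_cons {A : Set (List Step)} {z : ℤ} (h : HasCard A z) (s : Step) :
    HasCard (List.cons s '' A) z :=
  ⟨h.1.image _, by rw [Set.ncard_image_of_injective _ (List.cons_injective), h.2]⟩

theorem HasCard.union {α : Type*} {A B : Set α} {x y : ℤ} (hA : HasCard A x) (hB : HasCard B y)
    (h : Disjoint A B) : HasCard (A ∪ B) (x + y) :=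
  ⟨hA.1.union hB.1, by rw [Set.ncard_union_eq h hA.1 hB.1, Nat.cast_add, hA.2, hB.2]⟩

theorem HasCard.of_cons {A : Set (List Step)} {x y z : ℤ} (h0 : [] ∉ A)
    (hN : HasCard {l | Step.N :: l ∈ A} x) (hE : HasCard {l | Step.E :: l ∈ A} y)
    (hD : HasCard {l | Step.D :: l ∈ A} z) : HasCard A (x + (y + z)) := by
  have hA : A = List.cons Step.N '' {l | Step.N :: l ∈ A} ∪
      (List.cons Step.E '' {l | Step.E :: l ∈ A} ∪
        List.cons Step.D '' {l | Step.D :: l ∈ A}) := by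
    ext P
    rcases P with _ | ⟨s, l⟩
    · simp [h0]
    · cases s <;> simp
  rw [hA]
  refine (hN.image_cons _).union ((hE.image_cons _).union (hD.image_cons _) ?_) ?_
  · rw [Set.disjoint_left]
    rintro _ ⟨l, -, rfl⟩ ⟨l', -, h⟩
    simp at h
  · rw [Set.disjoint_left]
    rintro _ ⟨l, -, rfl⟩ (⟨l', -, h⟩ | ⟨l', -, h⟩) <;> simp at h

/-- The set of completions of a path. -/
def completionSet (m X Y d c : ℤ) : Set (List Step) := {P | IsCompletion m X Y d c P}

theorem completionSet_of_neg {m X Y d c : ℤ} (h : Y < 0 ∨ c < 0) :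
    completionSet m X Y d c = ∅ := by
  ext P
  simp only [completionSet, Set.mem_ofPred_eq, Set.mem_empty_iff_false, iff_false]
  intro hP
  have := hP.nonneg
  have := hP.cornered_nonneg
  omega

theorem completionSet_north {m X Y d c : ℤ} (h : m * (Y - 1) < X) :
    {l | Step.N :: l ∈ completionSet m X Y d c} = completionSet m X (Y - 1) d c := by
  ext l
  simp [completionSet, isCompletion_cons, stepVec, h]

theorem completionSet_east {m X Y d c : ℤ} (h : m * Y < X - 1 ∨ X = 1 ∧ Y = 0) :
    {l | Step.E :: l ∈ completionSet m X Y d c} = completionSet m (X - 1) Y d c := by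
  ext l
  simp only [completionSet, isCompletion_cons, stepVec, Set.mem_ofPred_eq]
  rcases h with h | ⟨rfl, rfl⟩
  · simp [h]
  · simp [isCompletion_zero_zero]

theorem completionSet_east_eq_empty {m X Y d c : ℤ} (h : X - 1 ≤ m * Y) (h' : X ≠ 1) :
    {l | Step.E :: l ∈ completionSet m X Y d c} = ∅ := by
  ext l
  simp only [completionSet, isCompletion_cons, stepVec, Set.mem_ofPred_eq,
    Set.mem_empty_iff_false, iff_false]
  rintro ⟨rfl | h1, -, h2⟩
  · rw [isCompletion_nil] at h2
    omega
  · simp at h1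
    omega

theorem completionSet_diag_eq_empty {m X Y d c : ℤ} (h : ¬ m ∣ X - 1) :
    {l | Step.D :: l ∈ completionSet m X Y d c} = ∅ := by
  ext l
  simp [completionSet, isCompletion_cons, stepVec, h]

theorem completionSet_diag {m X Y d c : ℤ} (h : m * (Y - 1) < X - 1) (h' : m ∣ X - 1) :
    {l | Step.D :: l ∈ completionSet m X Y d c} =
      completionSet m (X - 1) (Y - 1) (d - 1) (c - if X - 1 = m * Y then 1 else 0) := by
  ext l
  simp [completionSet, isCompletion_cons, stepVec, h, h']

theorem hasCard_completionSet {m : ℤ} (hm : 1 ≤ m) (N : ℕ) :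
    ∀ r ρ Y d c : ℤ, 0 ≤ r → 1 ≤ ρ → ρ ≤ m → Y ≤ r → 0 ≤ c → m * r + ρ + Y < N →
      HasCard (completionSet m (m * r + ρ) Y d c) (completions m r (m * r + ρ) Y d c) := by
  induction N with
  | zero =>
    intro r ρ Y d c hr hρ _ hY hc hN
    have : 0 ≤ m * r := by positivity
    push_cast at hN
    rw [completionSet_of_neg (by omega), completions_of_neg _ _ _ (by omega) hc]
    exact HasCard.empty
  | succ N ih =>
    intro r ρ Y d c hr hρ hρm hY hc hN
    push_cast at hN
    rcases lt_or_ge Y 0 with hY0 | hY0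
    · rw [completionSet_of_neg (by omega), completions_of_neg _ _ _ (by omega) hc]
      exact HasCard.empty
    have hmr : 0 ≤ m * r := by positivity
    have hmY : m * Y ≤ m * r := by gcongr
    have hnil : [] ∉ completionSet m (m * r + ρ) Y d c := by
      simp only [completionSet, Set.mem_ofPred_eq, isCompletion_nil]
      omega
    have hNorth : HasCard {l | Step.N :: l ∈ completionSet m (m * r + ρ) Y d c}
        (completions m r (m * r + ρ) (Y - 1) d c) := by
      rw [completionSet_north (by rw [mul_sub]; omega)]
      exact ih r ρ (Y - 1) d c hr hρ hρm (by omega) hc (by omega)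
    rcases eq_or_lt_of_le hρ with rfl | hρ1
    · rw [completions_rec m r (by omega) Y d c, add_sub_cancel_right]
      rcases eq_or_lt_of_le hr with rfl | hr1
      · obtain rfl : Y = 0 := by omega
        have hD : HasCard {l | Step.D :: l ∈ completionSet m (m * 0 + 1) 0 d c} 0 := by
          rw [completionSet_diag (by omega) (by simp), completionSet_of_neg (by omega)]
          exact HasCard.empty
        have hE : HasCard {l | Step.E :: l ∈ completionSet m (m * 0 + 1) 0 d c}
            (completions m 0 (m * 0) 0 d c) := by
          rw [completionSet_east (by simp), mul_zero, completions_zero m d hc, zero_add, sub_self]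
          have : completionSet m 0 0 d c = {P | P = [] ∧ d = 0 ∧ c = 0} := by
            ext P
            simp [completionSet, isCompletion_zero_zero]
          rw [this]
          split_ifs with h
          · simp [h, HasCard]
          · simp [h, HasCard]
        have := HasCard.of_cons hnil hNorth hE hD
        rwa [add_zero] at this
      · have hX : m * r = m * (r - 1) + m := by ring
        rcases eq_or_lt_of_le hY with rfl | hYr
        · have hE : HasCard {l | Step.E :: l ∈ completionSet m (m * Y + 1) Y d c} 0 := by
            rw [completionSet_east_eq_empty (by omega) (by nlinarith)]
            exact HasCard.empty
          have hD : HasCard {l | Step.D :: l ∈ completionSet m (m * Y + 1) Y d c}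
              (completions m Y (m * Y) Y d c) := by
            rw [completionSet_diag (by rw [mul_sub]; omega) (by simp)]
            rw [if_pos (by omega), add_sub_cancel_right]
            rcases eq_or_lt_of_le hc with rfl | hc1
            · rw [completionSet_of_neg (by omega), completions_boundary hm (by omega)]
              exact HasCard.empty
            · rw [completions_corner]
              have := ih (Y - 1) m (Y - 1) (d - 1) (c - 1) (by omega) hm le_rfl le_rfl
                (by omega) (by omega)
              rwa [← hX] at this
          have := HasCard.of_cons hnil hNorth hE hD
          rwa [zero_add] at this
        · have hlt : m * Y + m ≤ m * r := by nlinarith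
          have hE : HasCard {l | Step.E :: l ∈ completionSet m (m * r + 1) Y d c}
              (completions m (r - 1) (m * r) Y d c) := by
            rw [completionSet_east (by omega), add_sub_cancel_right]
            have := ih (r - 1) m Y d c (by omega) hm le_rfl (by omega) hc (by omega)
            rwa [← hX] at this
          have hD : HasCard {l | Step.D :: l ∈ completionSet m (m * r + 1) Y d c}
              (completions m (r - 1) (m * r) (Y - 1) (d - 1) c) := by
            rw [completionSet_diag (by rw [mul_sub]; omega) (by simp)]
            rw [if_neg (by omega), add_sub_cancel_right, sub_zero]
            have := ih (r - 1) m (Y - 1) (d - 1) c (by omega) hm le_rfl (by omega) hc (by omega)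
            rwa [← hX] at this
          rw [completions_decide m r (m * r) Y d c]
          exact HasCard.of_cons hnil hNorth hE hD
    · have hE : HasCard {l | Step.E :: l ∈ completionSet m (m * r + ρ) Y d c}
          (completions m r (m * r + ρ - 1) Y d c) := by
        rw [completionSet_east (by omega), add_sub_assoc]
        exact ih r (ρ - 1) Y d c hr (by omega) (by omega) hY hc (by omega)
      have hD : HasCard {l | Step.D :: l ∈ completionSet m (m * r + ρ) Y d c} 0 := by
        rw [completionSet_diag_eq_empty]
        · exact HasCard.empty
        · rw [add_sub_assoc, Int.dvd_add_right (dvd_mul_right m r)]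
          intro h
          have := Int.le_of_dvd (by omega) h
          omega
      have := HasCard.of_cons hnil hNorth hE hD
      rw [add_zero] at this
      rwa [completions_rec m r (by omega) Y d c]

theorem positive_schroeder_iff (m n a b : ℤ) (S : List Step) :
    (IsSchroeder m n 1 S ∧ IsPositive m S ∧ MDivisible m S ∧ (dg S : ℤ) = a ∧ (cd m S : ℤ) = b) ↔
      StartsNorth 1 S ∧ IsCompletion m (m * n) n a b S := by
  have hdg : diagCount (fun _ => True) S = dg S := by
    simp [diagCount, dg]
  have hcd : diagCount (fun v => m * n - v.1 = m * (n - v.2 + 1)) S = cd m S := by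
    unfold diagCount cd
    congr 1
    refine Finset.filter_congr fun j _ => ?_
    constructor <;> intro h <;> linarith
  have hdiv : (∀ j : ℕ, S[j]? = some Step.D → m ∣ m * n - (pt S (j + 1)).1) ↔
      MDivisible m S := by
    simp only [MDivisible, mem_diags]
    refine forall₂_congr fun j _ => ?_
    exact dvd_sub_right (dvd_mul_right m n)
  have habove (hend : pt S S.length = (m * n, n)) :
      (∀ k : ℕ, 0 < k → k < S.length → m * (n - (pt S k).2) < m * n - (pt S k).1) ↔
        AboveLine m S ∧ IsPositive m S := by
    constructor
    · refine fun h => ⟨fun k => ?_, fun k hk hk' => ?_⟩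
      · rcases Nat.eq_zero_or_pos k with rfl | hk
        · simp [pt_zero]
        rcases lt_or_ge k S.length with hk' | hk'
        · have := h k hk hk'
          linarith
        · rw [pt_of_length_le S hk', hend]
      · have := h k hk hk'
        intro h
        linarith
    · rintro ⟨h, h'⟩ k hk hk'
      have := lt_of_le_of_ne (h k) (h' k hk hk')
      linarith
  unfold IsSchroeder IsCompletion
  rw [hdg, hcd, hdiv]
  constructor
  · rintro ⟨⟨h1, h2, h3⟩, h4, h5, h6, h7⟩
    exact ⟨h1, h2, (habove h2).mpr ⟨h3, h4⟩, h5, h6, h7⟩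
  · rintro ⟨h1, h2, h3, h5, h6, h7⟩
    obtain ⟨h3, h4⟩ := (habove h2).mp h3
    exact ⟨⟨h1, h2, h3⟩, h4, h5, h6, h7⟩

theorem startsNorth_one_iff (S : List Step) : StartsNorth 1 S ↔ ∃ l, S = Step.N :: l := by
  constructor
  · rintro ⟨l, rfl⟩
    exact ⟨l, by simp⟩
  · rintro ⟨l, rfl⟩
    exact ⟨l, by simp⟩

theorem hasCard_positive_schroeder {m n b : ℤ} (a : ℤ) (hm : 1 ≤ m) (hn : 1 ≤ n) (hb : 0 ≤ b) :
    HasCard {S : List Step | IsSchroeder m n 1 S ∧ IsPositive m S ∧ MDivisible m S ∧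
      (dg S : ℤ) = a ∧ (cd m S : ℤ) = b} (completions m (n - 1) (m * n) (n - 1) a b) := by
  have hset : {S : List Step | IsSchroeder m n 1 S ∧ IsPositive m S ∧ MDivisible m S ∧
      (dg S : ℤ) = a ∧ (cd m S : ℤ) = b} =
      List.cons Step.N '' completionSet m (m * n) (n - 1) a b := by
    rw [← completionSet_north (by nlinarith)]
    ext S
    rw [Set.mem_ofPred_eq, positive_schroeder_iff, startsNorth_one_iff]
    constructor
    · rintro ⟨⟨l, rfl⟩, h⟩
      exact ⟨l, h, rfl⟩
    · rintro ⟨l, h, rfl⟩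
      exact ⟨⟨l, rfl⟩, h⟩
  rw [hset]
  have := hasCard_completionSet hm (m * n + n).toNat (n - 1) m (n - 1) a b (by omega) hm le_rfl
    le_rfl hb (by
      have : 0 ≤ m * n := by positivity
      rw [mul_sub]
      omega)
  rw [show m * (n - 1) + m = m * n by ring] at this
  exact this.image_cons _

/-- combinatorial reciprocity between `(m,1)`-Dyck paths and `m`-divisible
positive `(m,1)`-Schröder paths. -/
theorem statement10 (m n a b : ℤ) (hm : 1 ≤ m) (hn : 1 ≤ n)
    (hb : 0 ≤ b) (hba : b ≤ a) (ha : a ≤ n - 1) :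
    ((C (n - b - 2) (a - b) * C (-(m * n)) (n - 1 - a)
        + m * C (n - b - 1) (a - b) * C (-(m * n) - 1) (n - a - 2) : ℤ) : ℚ)
      = (-1 : ℚ) ^ (n - 1 - a).toNat
        * (({S : List Step | IsSchroeder m n 1 S ∧ IsPositive m S ∧ MDivisible m S ∧
            (dg S : ℤ) = a ∧ (cd m S : ℤ) = b}.ncard : ℚ)) := by
  have hcard := (hasCard_positive_schroeder a hm hn hb).2
  have hmn : 0 ≤ m * n := by positivity
  have h1 := C_neg_eq_multi hmn (n - 1 - a)
  have h2 := C_neg_eq_multi (X := m * n + 1) (by omega) (n - a - 2)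
  rw [show -(m * n + 1) = -(m * n) - 1 by ring] at h2
  suffices h : C (n - b - 2) (a - b) * C (-(m * n)) (n - 1 - a)
        + m * C (n - b - 1) (a - b) * C (-(m * n) - 1) (n - a - 2)
      = (-1) ^ (n - 1 - a).toNat * completions m (n - 1) (m * n) (n - 1) a b by
    rw [h, ← hcard]
    push_cast
    rfl
  rw [h1, h2]
  unfold completions
  rw [show n - 1 - 1 - b = n - b - 2 by ring, show n - 1 - b = n - b - 1 by ring,
    show n - 1 - a - 1 = n - a - 2 by ring]
  rcases eq_or_lt_of_le ha with rfl | ha'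
  · rw [multi_of_neg (k := n - (n - 1) - 2) (by omega)]
    ring
  · rw [show (n - 1 - a).toNat = (n - a - 2).toNat + 1 by omega]
    ring
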